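/- Suppose f, h : [z_h − ϱ, z_h + ϱ] → ℝ with f continuous, h differentiable, h(z_h) = 0, m := min over the interval of |h'| > 0, and f = h + ε where E := max |ε| < min{|h(z_h − ϱ)|, |h(z_h + ϱ)|}. Then f has a zero z_f in [z_h − ϱ, z_h + ϱ] with |z_f − z_h| ≤ E/m. -/

import Mathlib

open Set

theorem stmt_15_aux (zh ϱ m E : ℝ) (hϱ : 0 < ϱ) (hm : 0 < m)
    (f h h' : ℝ → ℝ)
    (hf : ContinuousOn f (Icc (zh - ϱ) (zh + ϱ)))
    (hh : ∀ x ∈ Icc (zh - ϱ) (zh + ϱ), HasDerivAt h (h' x) x)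
    (hzero : h zh = 0)
    (hm' : ∀ x ∈ Icc (zh - ϱ) (zh + ϱ), m ≤ h' x)
    (hE : ∀ x ∈ Icc (zh - ϱ) (zh + ϱ), |f x - h x| ≤ E)
    (hEsmall : E < min |h (zh - ϱ)| |h (zh + ϱ)|) :
    ∃ zf ∈ Icc (zh - ϱ) (zh + ϱ), f zf = 0 ∧ |zf - zh| ≤ E / m := by
  have key : ∀ x ∈ Icc (zh - ϱ) (zh + ϱ), ∀ y ∈ Icc (zh - ϱ) (zh + ϱ), x < y →
      m * (y - x) ≤ h y - h x := by
    intro x hx y hy hxy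
    obtain ⟨c, hc, hce⟩ := exists_hasDerivAt_eq_slope h h' hxy
      (fun z hz => (hh z ⟨hx.1.trans hz.1, hz.2.trans hy.2⟩).continuousAt.continuousWithinAt)
      (fun z hz => hh z ⟨hx.1.trans hz.1.le, hz.2.le.trans hy.2⟩)
    have h1 := hm' c ⟨hx.1.trans hc.1.le, hc.2.le.trans hy.2⟩
    rw [hce, le_div_iff₀ (by linarith)] at h1
    exact h1
  have ha : zh - ϱ ∈ Icc (zh - ϱ) (zh + ϱ) := ⟨by linarith, by linarith⟩
  have hb : zh + ϱ ∈ Icc (zh - ϱ) (zh + ϱ) := ⟨by linarith, by linarith⟩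
  have hz : zh ∈ Icc (zh - ϱ) (zh + ϱ) := ⟨by linarith, by linarith⟩
  have hmϱ := mul_pos hm hϱ
  have h1 := key _ ha _ hz (by linarith)
  have h2 := key _ hz _ hb (by linarith)
  rw [hzero] at h1 h2
  ring_nf at h1 h2
  have hl := hEsmall.trans_le (min_le_left _ _)
  have hr := hEsmall.trans_le (min_le_right _ _)
  rw [abs_of_neg (by linarith)] at hl
  rw [abs_of_pos (by linarith)] at hr
  have e1 := abs_le.1 (hE _ ha)
  have e2 := abs_le.1 (hE _ hb)
  obtain ⟨z, hzI, hz0⟩ := intermediate_value_Icc (by linarith) hf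
    (show (0:ℝ) ∈ _ from ⟨by linarith, by linarith⟩)
  refine ⟨z, hzI, hz0, ?_⟩
  rw [le_div_iff₀ hm]
  have e3 := abs_le.1 (hE _ hzI)
  rw [hz0] at e3
  rcases lt_trichotomy z zh with hlt | heq | hgt
  · have := key _ hzI _ hz hlt
    rw [abs_of_neg (by linarith)]
    linarith
  · subst heq
    simp
    linarith
  · have := key _ hz _ hzI hgt
    rw [abs_of_pos (by linarith)]
    linarith

theorem stmt_15 (zh ϱ m E : ℝ) (hϱ : 0 < ϱ) (hm : 0 < m)
    (f h h' : ℝ → ℝ)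
    (hf : ContinuousOn f (Icc (zh - ϱ) (zh + ϱ)))
    (hh : ∀ x ∈ Icc (zh - ϱ) (zh + ϱ), HasDerivAt h (h' x) x)
    (hzero : h zh = 0)
    (hm' : ∀ x ∈ Icc (zh - ϱ) (zh + ϱ), m ≤ |h' x|)
    (hE : ∀ x ∈ Icc (zh - ϱ) (zh + ϱ), |f x - h x| ≤ E)
    (hEsmall : E < min |h (zh - ϱ)| |h (zh + ϱ)|) :
    ∃ zf ∈ Icc (zh - ϱ) (zh + ϱ), f zf = 0 ∧ |zf - zh| ≤ E / m := by
  rcases hasDerivWithinAt_forall_lt_or_forall_gt_of_forall_ne (m := 0)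
    (convex_Icc (zh - ϱ) (zh + ϱ)) (fun x hx => (hh x hx).hasDerivWithinAt)
    (fun x hx h0 => by have := hm' x hx; rw [h0, abs_zero] at this; linarith) with hneg | hpos
  · obtain ⟨z, hz, h0, hb⟩ := stmt_15_aux zh ϱ m E hϱ hm (fun x => -f x) (fun x => -h x)
      (fun x => -h' x) hf.neg (fun x hx => (hh x hx).neg) (by simp [hzero])
      (fun x hx => by have := hm' x hx; rwa [abs_of_neg (hneg x hx)] at this)
      (fun x hx => by
        have := hE x hx
        rw [abs_sub_comm] at this
        rwa [neg_sub_neg])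
      (by simpa only [abs_neg] using hEsmall)
    exact ⟨z, hz, neg_eq_zero.1 h0, hb⟩
  · exact stmt_15_aux zh ϱ m E hϱ hm f h h' hf hh hzero
      (fun x hx => by have := hm' x hx; rwa [abs_of_pos (hpos x hx)] at this) hE hEsmall
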